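/- Let E be a real normed vector space, C ⊆ E a nonempty compact convex set, f : E → ℝ convex on C, Δ : E → E → ℝ, and C_f ≥ 0 a constant such that Δ satisfies the curvature bound C_f for f on C. Let x* ∈ C be a minimizer of f over C, let x ∈ C, α ∈ (0,1], ε ≥ 0, and let v ∈ C be an ε-approximate model minimizer at x with step-size α. Then f(x) − f(x*) ≤ −Δ x (α·(v − x))/α + (α/2)·C_f·(1 + ε). -/

import Mathlib

/-- Dual bound (Lemma): for convex abs-smooth `f` with abs-linearization `Δ`
satisfying the curvature bound `Cf` on `C`, minimizer `xs`, and `v` an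
`ε`-approximate model minimizer at `x` with step-size `α`, one has
`f x - f xs ≤ -Δ x (α • (v - x)) / α + (α/2) * Cf * (1 + ε)`. -/
theorem dual_bound_inexact
    {E : Type*} [NormedAddCommGroup E] [NormedSpace ℝ E]
    (C : Set E) (hCne : C.Nonempty) (hCcomp : IsCompact C) (hCconv : Convex ℝ C)
    (f : E → ℝ) (hf : ConvexOn ℝ C f)
    (Δ : E → E → ℝ) (Cf : ℝ) (hCf : 0 ≤ Cf)
    (hcurv : ∀ x ∈ C, ∀ v ∈ C, ∀ α ∈ Set.Ioc (0:ℝ) 1,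
      |f (x + α • (v - x)) - f x - Δ x (α • (v - x))| ≤ α ^ 2 / 2 * Cf)
    (xs : E) (hxs : xs ∈ C) (hmin : ∀ y ∈ C, f xs ≤ f y)
    (x : E) (hx : x ∈ C) (α : ℝ) (hα : α ∈ Set.Ioc (0:ℝ) 1)
    (ε : ℝ) (hε : 0 ≤ ε)
    (v : E) (hv : v ∈ C)
    (happrox : ∀ w ∈ C,
      Δ x (α • (v - x)) ≤ Δ x (α • (w - x)) + ε * α ^ 2 / 2 * Cf) :
    f x - f xs ≤ -Δ x (α • (v - x)) / α + α / 2 * Cf * (1 + ε) := by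
  obtain ⟨hα0, hα1⟩ := hα
  have hconv : f (x + α • (xs - x)) ≤ (1 - α) * f x + α * f xs := by
    have h := hf.2 hx hxs (sub_nonneg.2 hα1) hα0.le (sub_add_cancel 1 α)
    have hpt : (1 - α) • x + α • xs = x + α • (xs - x) := by module
    simpa only [hpt, smul_eq_mul] using h
  have hmodel := (abs_le.1 (hcurv x hx xs hxs α ⟨hα0, hα1⟩)).1
  have hv_le := happrox xs hxs
  have hrhs : -Δ x (α • (v - x)) / α + α / 2 * Cf * (1 + ε) =
      (-Δ x (α • (v - x)) + α ^ 2 / 2 * Cf * (1 + ε)) / α := by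
    field_simp
  rw [hrhs, le_div_iff₀ hα0]
  linarith
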